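/- Let G be an amenable discrete group, I a nonempty set, and A = ℓ¹(B(I,G)). Then for every two-sided A-induced Banach A-bimodule E and every n > 0, the bounded Hochschild cohomology group ℋⁿ(A,E*) with coefficients in the dual bimodule E* is trivial. -/

import Mathlib

open scoped TensorProduct BigOperators ENNReal
open Filter

noncomputable section

/-- `ℓ¹(X)`: the Banach space of absolutely summable complex functions on `X`. -/
abbrev L1 (X : Type) : Type := lp (fun _ : X => ℂ) 1

open Classical in
/-- The point mass `δ_x` in `ℓ¹(X)`. -/
noncomputable def delta {X : Type} (x : X) : L1 X := lp.single 1 x (1 : ℂ)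

/-- The projective tensor norm of an element of the algebraic tensor product
`E ⊗[ℂ] F`: the infimum of `∑ ‖xᵢ‖ ‖yᵢ‖` over all finite representations
`z = ∑ xᵢ ⊗ yᵢ`. -/
def projNorm {E F : Type} [SeminormedAddCommGroup E] [NormedSpace ℂ E]
    [SeminormedAddCommGroup F] [NormedSpace ℂ F] (z : E ⊗[ℂ] F) : ℝ :=
  sInf {r : ℝ | ∃ (n : ℕ) (x : Fin n → E) (y : Fin n → F),
    z = ∑ i, x i ⊗ₜ[ℂ] y i ∧ r = ∑ i, ‖x i‖ * ‖y i‖}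

/-- `(T, φ)` is a realization of the completed projective tensor product `E ⊗̂ F`:
`T` is a Banach space, the canonical map from the algebraic tensor product is an
isometry with respect to the projective tensor norm, and it has dense range. -/
structure IsProjTensor (E F T : Type) [SeminormedAddCommGroup E] [NormedSpace ℂ E]
    [SeminormedAddCommGroup F] [NormedSpace ℂ F]
    [SeminormedAddCommGroup T] [NormedSpace ℂ T]
    (φ : E →ₗ[ℂ] F →ₗ[ℂ] T) : Prop where
  complete : CompleteSpace T
  isometry : ∀ z : E ⊗[ℂ] F, ‖TensorProduct.lift φ z‖ = projNorm z
  dense : DenseRange ⇑(TensorProduct.lift φ)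

/-- The closed linear span of the `A`-balancing relations
`{x·a ⊗ y - x ⊗ a·y}` inside a realization `T` of `E ⊗̂ F`; the quotient
`T ⧸ balancer φ r l` is the `A`-module tensor product `E ⊗̂_A F`. -/
def balancer {A E F T : Type} [SeminormedAddCommGroup E] [NormedSpace ℂ E]
    [SeminormedAddCommGroup F] [NormedSpace ℂ F]
    [SeminormedAddCommGroup T] [NormedSpace ℂ T]
    (φ : E →ₗ[ℂ] F →ₗ[ℂ] T) (r : E → A → E) (l : A → F → F) : Submodule ℂ T :=
  (Submodule.span ℂ {z : T | ∃ (x : E) (a : A) (y : F), z = φ (r x a) y - φ x (l a y)}).topologicalClosure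

/-- A left Banach `A`-module `(E, l)` is `A`-induced: for every realization `T` of
`A ⊗̂ E`, the canonical map `A ⊗̂_A E → E`, `a ⊗ x ↦ a·x`, is a topological
isomorphism. -/
def LeftInduced {A E : Type} [SeminormedAddCommGroup A] [NormedSpace ℂ A]
    [SeminormedAddCommGroup E] [NormedSpace ℂ E]
    (mulA : A →L[ℂ] A →L[ℂ] A) (l : A →L[ℂ] E →L[ℂ] E) : Prop :=
  ∀ (T : Type) [SeminormedAddCommGroup T] [NormedSpace ℂ T]
    (φ : A →ₗ[ℂ] E →ₗ[ℂ] T), IsProjTensor A E T φ →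
    ∃ e : (T ⧸ balancer φ (fun a b => mulA a b) (fun a x => l a x)) ≃L[ℂ] E,
      ∀ (a : A) (x : E), e (Submodule.Quotient.mk (φ a x)) = l a x

/-- A right Banach `A`-module `(E, r)` is `A`-induced. -/
def RightInduced {A E : Type} [SeminormedAddCommGroup A] [NormedSpace ℂ A]
    [SeminormedAddCommGroup E] [NormedSpace ℂ E]
    (mulA : A →L[ℂ] A →L[ℂ] A) (r : E →L[ℂ] A →L[ℂ] E) : Prop :=
  ∀ (T : Type) [SeminormedAddCommGroup T] [NormedSpace ℂ T]
    (φ : E →ₗ[ℂ] A →ₗ[ℂ] T), IsProjTensor E A T φ →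
    ∃ e : (T ⧸ balancer φ (fun x a => r x a) (fun a b => mulA a b)) ≃L[ℂ] E,
      ∀ (x : E) (a : A), e (Submodule.Quotient.mk (φ x a)) = r x a

/-- A Banach algebra `(A, mul)` is self-induced: the multiplication map
`A ⊗̂_A A → A` is an isomorphism of `A`-bimodules. -/
def SelfInduced {A : Type} [SeminormedAddCommGroup A] [NormedSpace ℂ A]
    (mulA : A →L[ℂ] A →L[ℂ] A) : Prop :=
  ∀ (T : Type) [SeminormedAddCommGroup T] [NormedSpace ℂ T]
    (φ : A →ₗ[ℂ] A →ₗ[ℂ] T), IsProjTensor A A T φ →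
    ∃ e : (T ⧸ balancer φ (fun a b => mulA a b) (fun a b => mulA a b)) ≃L[ℂ] A,
      (∀ a b : A, e (Submodule.Quotient.mk (φ a b)) = mulA a b) ∧
      (∀ c a b : A, e (Submodule.Quotient.mk (φ (mulA c a) b))
          = mulA c (e (Submodule.Quotient.mk (φ a b)))) ∧
      (∀ a b c : A, e (Submodule.Quotient.mk (φ a (mulA b c)))
          = mulA (e (Submodule.Quotient.mk (φ a b))) c)

/-- `(E, l, r)` is a Banach bimodule: left over `(A, mulL)`, right over `(B, mulR)`. -/
def IsBimoduleLaw {A B E : Type} [SeminormedAddCommGroup A] [NormedSpace ℂ A]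
    [SeminormedAddCommGroup B] [NormedSpace ℂ B]
    [SeminormedAddCommGroup E] [NormedSpace ℂ E]
    (mulL : A →L[ℂ] A →L[ℂ] A) (mulR : B →L[ℂ] B →L[ℂ] B)
    (l : A →L[ℂ] E →L[ℂ] E) (r : E →L[ℂ] B →L[ℂ] E) : Prop :=
  (∀ (a a' : A) (x : E), l (mulL a a') x = l a (l a' x)) ∧
  (∀ (x : E) (b b' : B), r (r x b) b' = r x (mulR b b')) ∧
  (∀ (a : A) (x : E) (b : B), r (l a x) b = l a (r x b))

/-- The Brandt semigroup `B(I,G) = (I × G × I) ∪ {∘}`, with `∘ = none`. -/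
abbrev Brandt (I G : Type) : Type := Option (I × G × I)

open Classical in
/-- Multiplication of the Brandt semigroup: `(i,g,j)(i',g',j') = (i,gg',j')` if
`j = i'` and `∘` otherwise; `∘` is absorbing. -/
noncomputable instance {I G : Type} [Mul G] : Mul (Brandt I G) :=
  ⟨fun a b => match a, b with
    | some (i, g, j), some (i', g', j') => if j = i' then some (i, g * g', j') else none
    | _, _ => none⟩

open Classical in
/-- The convolution product on `ℓ¹(S)` for a (semi)group `S`:
`(a * b)(s) = ∑_{uv = s} a(u) b(v)`. -/
noncomputable def l1conv {S : Type} [Mul S] (a b : L1 S) (s : S) : ℂ :=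
  ∑' p : S × S, if p.1 * p.2 = s then a p.1 * b p.2 else 0

/-- A Banach algebra `(A, mul)` is amenable: every bounded derivation of `A` into the
dual of a Banach `A`-bimodule is inner. Here `(D b).comp (r.flip a)` is `a·(D b)` and
`(D a).comp (l b)` is `(D a)·b` in the dual bimodule `E*`. -/
def AmenableBA {A : Type} [NormedAddCommGroup A] [NormedSpace ℂ A]
    (mul : A →L[ℂ] A →L[ℂ] A) : Prop :=
  ∀ (E : Type) [NormedAddCommGroup E] [NormedSpace ℂ E] [CompleteSpace E]
    (l : A →L[ℂ] E →L[ℂ] E) (r : E →L[ℂ] A →L[ℂ] E),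
    (∀ (a a' : A) (x : E), l (mul a a') x = l a (l a' x)) →
    (∀ (x : E) (a a' : A), r (r x a) a' = r x (mul a a')) →
    (∀ (a : A) (x : E) (a' : A), r (l a x) a' = l a (r x a')) →
    ∀ D : A →L[ℂ] (E →L[ℂ] ℂ),
      (∀ a b : A, D (mul a b) = (D b).comp (r.flip a) + (D a).comp (l b)) →
      ∃ ξ : E →L[ℂ] ℂ, ∀ a : A, D a = ξ.comp (r.flip a) - ξ.comp (l a)

/-- A Banach algebra `(A, mul)` is approximately amenable: every bounded derivation
into a dual bimodule is approximately inner, i.e. a norm-limit of inner ones along a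
net. -/
def ApproxAmenableBA {A : Type} [NormedAddCommGroup A] [NormedSpace ℂ A]
    (mul : A →L[ℂ] A →L[ℂ] A) : Prop :=
  ∀ (E : Type) [NormedAddCommGroup E] [NormedSpace ℂ E] [CompleteSpace E]
    (l : A →L[ℂ] E →L[ℂ] E) (r : E →L[ℂ] A →L[ℂ] E),
    (∀ (a a' : A) (x : E), l (mul a a') x = l a (l a' x)) →
    (∀ (x : E) (a a' : A), r (r x a) a' = r x (mul a a')) →
    (∀ (a : A) (x : E) (a' : A), r (l a x) a' = l a (r x a')) →
    ∀ D : A →L[ℂ] (E →L[ℂ] ℂ),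
      (∀ a b : A, D (mul a b) = (D b).comp (r.flip a) + (D a).comp (l b)) →
      ∃ (ι : Type) (F : Filter ι), F.NeBot ∧ ∃ f : ι → (E →L[ℂ] ℂ),
        ∀ a : A, Tendsto (fun lam => (f lam).comp (r.flip a) - (f lam).comp (l a))
          F (nhds (D a))

/-- A discrete group `G` is amenable: there is a translation-invariant mean on
`ℓ∞(G)`. -/
def AmenableGroup (G : Type) [Group G] : Prop :=
  ∃ m : lp (fun _ : G => ℝ) ∞ →ₗ[ℝ] ℝ,
    (∀ f : lp (fun _ : G => ℝ) ∞, (∀ x, 0 ≤ f x) → 0 ≤ m f) ∧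
    (∀ f : lp (fun _ : G => ℝ) ∞, (∀ x, f x = 1) → m f = 1) ∧
    (∀ (g : G) (f f' : lp (fun _ : G => ℝ) ∞), (∀ x, f' x = f (g * x)) → m f' = m f)

/-- Merge the adjacent entries `a i, a (i+1)` of a tuple using the multiplication
`mul`, producing a tuple one entry shorter (used for Hochschild (co)boundaries). -/
noncomputable def mergeMul {A : Type} (mul : A → A → A) {n : ℕ}
    (a : Fin (n + 1) → A) (i : Fin n) : Fin n → A := fun j =>
  if j.val < i.val then a j.castSucc
  else if j = i then mul (a i.castSucc) (a i.succ)
  else a j.succ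

/-- The Hochschild coboundary of a (raw) `n`-cochain with values in the dual
bimodule `E*`:
`(δu)(a₀,…,aₙ) = a₀·u(a₁,…,aₙ) + ∑ (-1)^{i+1} u(…,aᵢaᵢ₊₁,…) + (-1)^{n+1} u(a₀,…,aₙ₋₁)·aₙ`. -/
noncomputable def cob {A E : Type} [NormedAddCommGroup A] [NormedSpace ℂ A]
    [NormedAddCommGroup E] [NormedSpace ℂ E]
    (mul : A →L[ℂ] A →L[ℂ] A) (l : A →L[ℂ] E →L[ℂ] E) (r : E →L[ℂ] A →L[ℂ] E)
    (n : ℕ) (u : (Fin n → A) → (E →L[ℂ] ℂ)) : (Fin (n + 1) → A) → (E →L[ℂ] ℂ) :=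
  fun a =>
    (u (Fin.tail a)).comp (r.flip (a 0))
      + ∑ i : Fin n, ((-1 : ℂ) ^ (i.val + 1)) • u (mergeMul (fun x y => mul x y) a i)
      + ((-1 : ℂ) ^ (n + 1)) • (u (Fin.init a)).comp (l (a (Fin.last n)))

/-- A raw cochain is a bounded `n`-linear map `Aⁿ → E*`. -/
def IsCochain {A E : Type} [NormedAddCommGroup A] [NormedSpace ℂ A]
    [NormedAddCommGroup E] [NormedSpace ℂ E]
    (n : ℕ) (u : (Fin n → A) → (E →L[ℂ] ℂ)) : Prop :=
  (∀ (a : Fin n → A) (i : Fin n) (x y : A),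
      u (Function.update a i (x + y)) = u (Function.update a i x) + u (Function.update a i y)) ∧
  (∀ (a : Fin n → A) (i : Fin n) (c : ℂ) (x : A),
      u (Function.update a i (c • x)) = c • u (Function.update a i x)) ∧
  (∃ M : ℝ, ∀ a : Fin n → A, ‖u a‖ ≤ M * ∏ i, ‖a i‖)

section Helpers
open Classical

theorem l1_summable {S E : Type} [NormedAddCommGroup E] (a : lp (fun _ : S => E) 1) :
    Summable fun s => ‖a s‖ := by
  have h := (memℓp_gen_iff (p := 1) (by simp)).1 (lp.memℓp a)
  simpa using h

theorem l1_norm {S E : Type} [NormedAddCommGroup E] (a : lp (fun _ : S => E) 1) :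
    ‖a‖ = ∑' s, ‖a s‖ := by
  have h := lp.norm_eq_tsum_rpow (p := 1) (by simp) a
  simpa using h

theorem l1_hasSum {S E : Type} [NormedAddCommGroup E] (a : lp (fun _ : S => E) 1) :
    HasSum (fun s => (lp.single 1 s (a s) : lp (fun _ : S => E) 1)) a :=
  lp.hasSum_single (by simp) a

theorem l1_ext {S E X : Type} [NormedAddCommGroup E] [NormedSpace ℂ E]
    [NormedAddCommGroup X] [NormedSpace ℂ X]
    (P Q : lp (fun _ : S => E) 1 →L[ℂ] X)
    (h : ∀ s x, P (lp.single 1 s x) = Q (lp.single 1 s x)) : P = Q := by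
  ext a
  have h1 := P.hasSum (l1_hasSum a)
  have h2 := Q.hasSum (l1_hasSum a)
  simp only [h] at h1
  exact h1.unique h2

theorem lift_summable {S E X : Type} [NormedAddCommGroup E] [NormedSpace ℂ E]
    [NormedAddCommGroup X] [NormedSpace ℂ X] [CompleteSpace X]
    (V : S → E →L[ℂ] X) (C : ℝ) (hV : ∀ s, ‖V s‖ ≤ C) (a : lp (fun _ : S => E) 1) :
    Summable fun s => V s (a s) := by
  refine Summable.of_norm_bounded ((l1_summable a).mul_left C) fun s => ?_
  exact ((V s).le_opNorm _).trans (by gcongr; exact hV s)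

/-- The universal map out of a vector valued `ℓ¹` space. -/
def lift1 {S E X : Type} [NormedAddCommGroup E] [NormedSpace ℂ E]
    [NormedAddCommGroup X] [NormedSpace ℂ X] [CompleteSpace X]
    (V : S → E →L[ℂ] X) (C : ℝ) (hV : ∀ s, ‖V s‖ ≤ C) : lp (fun _ : S => E) 1 →L[ℂ] X :=
  LinearMap.mkContinuous
    { toFun := fun a => ∑' s, V s (a s)
      map_add' := fun a b => by
        simp only [lp.coeFn_add, Pi.add_apply, map_add]
        exact (lift_summable V C hV a).tsum_add (lift_summable V C hV b)
      map_smul' := fun c a => by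
        simp only [lp.coeFn_smul, Pi.smul_apply, map_smul, RingHom.id_apply]
        exact (lift_summable V C hV a).tsum_const_smul c } C
    (fun a => by
      show ‖∑' s, V s (a s)‖ ≤ _
      rw [l1_norm, ← tsum_mul_left]
      refine tsum_of_norm_bounded ((l1_summable a).mul_left C).hasSum fun s => ?_
      exact ((V s).le_opNorm _).trans (by gcongr; exact hV s))

theorem lift1_apply {S E X : Type} [NormedAddCommGroup E] [NormedSpace ℂ E]
    [NormedAddCommGroup X] [NormedSpace ℂ X] [CompleteSpace X]
    (V : S → E →L[ℂ] X) (C : ℝ) (hV : ∀ s, ‖V s‖ ≤ C) (a : lp (fun _ : S => E) 1) :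
    lift1 V C hV a = ∑' s, V s (a s) := rfl

theorem lift1_norm {S E X : Type} [NormedAddCommGroup E] [NormedSpace ℂ E]
    [NormedAddCommGroup X] [NormedSpace ℂ X] [CompleteSpace X]
    (V : S → E →L[ℂ] X) (C : ℝ) (hC : 0 ≤ C) (hV : ∀ s, ‖V s‖ ≤ C) :
    ‖lift1 V C hV‖ ≤ C := LinearMap.mkContinuous_norm_le _ hC _

theorem norm_delta {X : Type} (x : X) : ‖delta x‖ = 1 := by
  unfold delta
  rw [lp.norm_single (by simp)]; simp

theorem delta_apply {X : Type} (x y : X) : delta x y = if x = y then 1 else 0 := by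
  unfold delta
  rw [lp.single_apply]
  by_cases h : x = y
  · subst h; simp
  · simp [h, Ne.symm h]

theorem single_eq_delta {X : Type} (x : X) (c : ℂ) :
    (lp.single 1 x c : L1 X) = c • delta x := by
  unfold delta
  rw [← lp.single_smul]; simp

/-- Left translation by `s` on `ℓ¹(S)`. -/
def transL {S : Type} [Mul S] (s : S) : L1 S →L[ℂ] L1 S :=
  lift1 (fun t => ContinuousLinearMap.toSpanSingleton ℂ (delta (s * t))) 1
    (fun t => by rw [ContinuousLinearMap.norm_toSpanSingleton, norm_delta])

/-- Convolution. -/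
def convS {S : Type} [Mul S] : L1 S →L[ℂ] L1 S →L[ℂ] L1 S :=
  lift1 (fun s => ContinuousLinearMap.toSpanSingleton ℂ (transL s)) 1
    (fun t => by
      rw [ContinuousLinearMap.norm_toSpanSingleton]
      exact lift1_norm _ _ zero_le_one _)

theorem lift1_hasSum {S E X : Type} [NormedAddCommGroup E] [NormedSpace ℂ E]
    [NormedAddCommGroup X] [NormedSpace ℂ X] [CompleteSpace X]
    (V : S → E →L[ℂ] X) (C : ℝ) (hV : ∀ s, ‖V s‖ ≤ C) (a : lp (fun _ : S => E) 1) :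
    HasSum (fun s => V s (a s)) (lift1 V C hV a) :=
  (lift_summable V C hV a).hasSum

/-- Evaluation at a point. -/
def ev1 {S : Type} (u : S) : L1 S →L[ℂ] ℂ :=
  lift1 (fun t => if t = u then ContinuousLinearMap.id ℂ ℂ else 0) 1
    (fun t => by split_ifs <;> simp)

theorem ev1_apply {S : Type} (u : S) (a : L1 S) : ev1 u a = a u := by
  unfold ev1
  rw [lift1_apply, tsum_eq_single u]
  · simp
  · intro b hb; simp [hb]

theorem lift1_single {S E X : Type} [NormedAddCommGroup E] [NormedSpace ℂ E]
    [NormedAddCommGroup X] [NormedSpace ℂ X] [CompleteSpace X]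
    (V : S → E →L[ℂ] X) (C : ℝ) (hV : ∀ s, ‖V s‖ ≤ C) (s : S) (x : E) :
    lift1 V C hV (lp.single 1 s x) = V s x := by
  rw [lift1_apply, tsum_eq_single s]
  · simp
  · intro b hb; simp [lp.single_apply, hb]

theorem convS_delta {S : Type} [Mul S] (s t : S) :
    convS (delta s) (delta t) = delta (s * t) := by
  have h1 : convS (delta s) = transL s := by
    unfold convS
    conv_lhs => rw [delta]
    rw [lift1_single]; simp
  rw [h1]
  unfold transL
  conv_lhs => rw [delta]
  rw [lift1_single]; simp

theorem convS_apply {S : Type} [Mul S] (a b : L1 S) (u : S) :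
    convS a b u = l1conv a b u := by
  have h1 := lift1_hasSum (fun s : S => ContinuousLinearMap.toSpanSingleton ℂ (transL s)) 1
    (fun t => by
      rw [ContinuousLinearMap.norm_toSpanSingleton]
      exact lift1_norm _ _ zero_le_one _) a
  have h2 := ((ev1 u).comp (ContinuousLinearMap.apply ℂ (L1 S) b)).hasSum h1
  have h3 : ∀ s : S, HasSum (fun t => if s * t = u then a s * b t else 0)
      (a s * (transL s b u)) := by
    intro s
    have := lift1_hasSum (fun t => ContinuousLinearMap.toSpanSingleton ℂ (delta (s * t))) 1
      (fun t => by rw [ContinuousLinearMap.norm_toSpanSingleton, norm_delta]) b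
    have h4 := ((ev1 u).hasSum this).mul_left (a s)
    simp only [ContinuousLinearMap.toSpanSingleton_apply, ev1_apply, lp.coeFn_smul,
      Pi.smul_apply, delta_apply, smul_eq_mul, mul_ite, mul_one, mul_zero] at h4
    exact h4
  have h5 : Summable fun p : S × S => if p.1 * p.2 = u then a p.1 * b p.2 else 0 := by
    refine Summable.of_norm_bounded
      (Summable.mul_of_nonneg (l1_summable a) (l1_summable b) (fun _ => norm_nonneg _)
        (fun _ => norm_nonneg _)) fun p => ?_
    split_ifs
    · simp
    · simp; positivity
  have h6 := h5.hasSum.prod_fiberwise h3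
  simp only [ContinuousLinearMap.comp_apply, ContinuousLinearMap.apply_apply, ev1_apply,
    ContinuousLinearMap.toSpanSingleton_apply, smul_apply, lp.coeFn_smul,
    Pi.smul_apply, smul_eq_mul] at h2
  unfold l1conv
  exact h2.unique h6

/-- extension of the mean to all complex functions -/
theorem exists_mean {G : Type} [Group G] (hG : AmenableGroup G) :
    ∃ μ : (G → ℂ) →ₗ[ℂ] ℂ,
      (∀ (f : G → ℂ) (C : ℝ), (∀ x, ‖f x‖ ≤ C) → ‖μ f‖ ≤ 2 * C) ∧
      (∀ c : ℂ, μ (fun _ => c) = c) ∧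
      (∀ (f : G → ℂ) (C : ℝ) (h : G), (∀ x, ‖f x‖ ≤ C) → μ (fun x => f (h * x)) = μ f) := by
  obtain ⟨m, hpos, hone, hinv⟩ := hG
  let ι : lp (fun _ : G => ℝ) ∞ →ₗ[ℝ] (G → ℝ) :=
    { toFun := fun f => f, map_add' := fun f g => rfl, map_smul' := fun c f => rfl }
  have hι : LinearMap.ker ι = ⊥ := by
    rw [LinearMap.ker_eq_bot]
    intro f g hfg
    exact lp.ext hfg
  obtain ⟨p, hp⟩ := LinearMap.exists_leftInverse_of_injective ι hι
  let m' : (G → ℝ) →ₗ[ℝ] ℝ := m.comp p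
  have hm' : ∀ f : lp (fun _ : G => ℝ) ∞, m' (fun x => f x) = m f := by
    intro f
    show m ((p.comp ι) f) = m f
    rw [hp]; rfl
  have hmem : ∀ (f : G → ℝ) (C : ℝ), (∀ x, |f x| ≤ C) → Memℓp f ∞ := by
    intro f C h
    refine memℓp_infty ⟨C, ?_⟩
    rintro _ ⟨x, rfl⟩
    exact h x
  have hmpos : ∀ (f : G → ℝ) (C : ℝ), (∀ x, |f x| ≤ C) → (∀ x, 0 ≤ f x) → 0 ≤ m' f := by
    intro f C h h0
    rw [hm' ⟨f, hmem f C h⟩]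
    exact hpos _ h0
  have hm1 : m' (fun _ => 1) = 1 := by
    rw [hm' ⟨fun _ => 1, hmem _ 1 (by simp)⟩]
    exact hone _ (fun _ => rfl)
  have hminv : ∀ (f : G → ℝ) (C : ℝ) (h : G), (∀ x, |f x| ≤ C) →
      m' (fun x => f (h * x)) = m' f := by
    intro f C h hf
    rw [hm' ⟨f, hmem f C hf⟩, hm' ⟨fun x => f (h * x), hmem _ C (fun x => hf _)⟩]
    exact hinv h _ _ (fun _ => rfl)
  have hmc : ∀ c : ℝ, m' (fun _ => c) = c := by
    intro c
    have : (fun _ : G => c) = c • (fun _ : G => (1 : ℝ)) := by ext; simp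
    rw [this, map_smul, hm1]; simp
  have hmb : ∀ (f : G → ℝ) (C : ℝ), (∀ x, |f x| ≤ C) → |m' f| ≤ C := by
    intro f C hf
    have h1 := hmpos ((fun _ => C) - f) (C + C)
      (fun x => by
        have := abs_le.1 (hf x)
        simp only [Pi.sub_apply]
        rw [abs_le]; constructor <;> linarith)
      (fun x => by have := abs_le.1 (hf x); simp only [Pi.sub_apply]; linarith)
    have h2 := hmpos ((fun _ => C) + f) (C + C)
      (fun x => by
        have := abs_le.1 (hf x)
        simp only [Pi.add_apply]
        rw [abs_le]; constructor <;> linarith)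
      (fun x => by have := abs_le.1 (hf x); simp only [Pi.add_apply]; linarith)
    rw [map_sub, hmc] at h1
    rw [map_add, hmc] at h2
    rw [abs_le]; constructor <;> linarith
  refine ⟨{ toFun := fun f => (m' (fun x => (f x).re) : ℂ) + (m' (fun x => (f x).im) : ℂ) * Complex.I
            map_add' := ?_, map_smul' := ?_ }, ?_, ?_, ?_⟩
  · intro f g
    have h1 : (fun x => ((f + g) x).re) = (fun x => (f x).re) + (fun x => (g x).re) := rfl
    have h2 : (fun x => ((f + g) x).im) = (fun x => (f x).im) + (fun x => (g x).im) := rfl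
    rw [h1, h2, map_add, map_add]; push_cast; ring
  · intro c f
    have h1 : (fun x => ((c • f) x).re) = c.re • (fun x => (f x).re) - c.im • (fun x => (f x).im) := by
      ext x; simp
    have h2 : (fun x => ((c • f) x).im) = c.re • (fun x => (f x).im) + c.im • (fun x => (f x).re) := by
      ext x; simp
    rw [h1, h2, map_add, map_sub, map_smul, map_smul, map_smul, map_smul]
    apply Complex.ext <;> simp
  · intro f C hf
    have h1 := hmb (fun x => (f x).re) C (fun x => (Complex.abs_re_le_norm _).trans (hf x))
    have h2 := hmb (fun x => (f x).im) C (fun x => (Complex.abs_im_le_norm _).trans (hf x))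
    refine (norm_add_le _ _).trans ?_
    rw [norm_mul, Complex.norm_I, Complex.norm_real, Complex.norm_real, Real.norm_eq_abs,
      Real.norm_eq_abs]
    linarith
  · intro c
    apply Complex.ext <;> simp [hmc]
  · intro f C h hf
    show ((m' (fun x => (f (h * x)).re) : ℝ) : ℂ) + ((m' (fun x => (f (h * x)).im) : ℝ) : ℂ) * Complex.I = _
    rw [hminv (fun x => (f x).re) C h (fun x => (Complex.abs_re_le_norm _).trans (hf x)),
      hminv (fun x => (f x).im) C h (fun x => (Complex.abs_im_le_norm _).trans (hf x))]
    rfl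

theorem projNorm_le_of_rep {E F : Type} [SeminormedAddCommGroup E] [NormedSpace ℂ E]
    [SeminormedAddCommGroup F] [NormedSpace ℂ F] (z : E ⊗[ℂ] F)
    {J : Type} [Fintype J] (x : J → E) (y : J → F) (h : z = ∑ j, x j ⊗ₜ[ℂ] y j) :
    projNorm z ≤ ∑ j, ‖x j‖ * ‖y j‖ := by
  unfold projNorm
  refine csInf_le ⟨0, ?_⟩ ?_
  · rintro _ ⟨n, x, y, -, rfl⟩
    positivity
  · let e := Fintype.equivFin J
    refine ⟨Fintype.card J, fun i => x (e.symm i), fun i => y (e.symm i), ?_, ?_⟩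
    · rw [h]
      exact (Equiv.sum_comp e.symm (fun j => x j ⊗ₜ[ℂ] y j)).symm
    · exact (Equiv.sum_comp e.symm (fun j => ‖x j‖ * ‖y j‖)).symm

theorem exists_rep {E F : Type} [SeminormedAddCommGroup E] [NormedSpace ℂ E]
    [SeminormedAddCommGroup F] [NormedSpace ℂ F] (z : E ⊗[ℂ] F) :
    ∃ (n : ℕ) (x : Fin n → E) (y : Fin n → F), z = ∑ i, x i ⊗ₜ[ℂ] y i := by
  induction z using TensorProduct.induction_on with
  | zero => exact ⟨0, Fin.elim0, Fin.elim0, by simp⟩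
  | tmul x y => exact ⟨1, fun _ => x, fun _ => y, by simp⟩
  | add a b ha hb =>
    obtain ⟨n, x, y, rfl⟩ := ha
    obtain ⟨n', x', y', rfl⟩ := hb
    refine ⟨n + n', Fin.append x x', Fin.append y y', ?_⟩
    rw [Fin.sum_univ_add]
    simp

/-- `(x, a) ↦ (s ↦ a s • x)`. -/
def tens (S E : Type) [NormedAddCommGroup E] [NormedSpace ℂ E] :
    E →ₗ[ℂ] L1 S →ₗ[ℂ] lp (fun _ : S => E) 1 :=
  LinearMap.mk₂ ℂ
    (fun x a => (⟨fun s => a s • x, by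
      refine (memℓp_gen_iff (by simp)).2 ?_
      simpa [norm_smul] using (l1_summable a).mul_right ‖x‖⟩ : lp (fun _ : S => E) 1))
    (fun x y a => by ext s; exact smul_add (a s) x y)
    (fun c x a => by ext s; exact smul_comm (a s) c x)
    (fun x a b => by ext s; exact add_smul (a s) (b s) x)
    (fun c x a => by ext s; exact mul_smul c (a s) x)

theorem tens_apply {S E : Type} [NormedAddCommGroup E] [NormedSpace ℂ E] (x : E) (a : L1 S)
    (s : S) : tens S E x a s = a s • x := rfl

theorem norm_tens {S E : Type} [NormedAddCommGroup E] [NormedSpace ℂ E] (x : E) (a : L1 S) :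
    ‖tens S E x a‖ = ‖x‖ * ‖a‖ := by
  rw [l1_norm, l1_norm, ← tsum_mul_left]
  refine tsum_congr fun s => ?_
  rw [tens_apply, norm_smul, mul_comm]

theorem tens_delta {S E : Type} [NormedAddCommGroup E] [NormedSpace ℂ E] (x : E) (s : S) :
    tens S E x (delta s) = lp.single 1 s x := by
  ext t
  rw [tens_apply, delta_apply, lp.single_apply]
  by_cases h : s = t
  · subst h; simp
  · simp [h, Ne.symm h]

theorem isProj_tens (S E : Type) [NormedAddCommGroup E] [NormedSpace ℂ E] [CompleteSpace E] :
    IsProjTensor E (L1 S) (lp (fun _ : S => E) 1) (tens S E) where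
  complete := inferInstance
  isometry := by
    intro z
    apply le_antisymm
    · refine le_csInf ?_ ?_
      · obtain ⟨n, x, y, h⟩ := exists_rep z
        exact ⟨_, n, x, y, h, rfl⟩
      · rintro _ ⟨n, x, y, rfl, rfl⟩
        rw [map_sum]
        refine (norm_sum_le _ _).trans (Finset.sum_le_sum fun i _ => ?_)
        rw [TensorProduct.lift.tmul, norm_tens]
    · refine le_of_forall_pos_le_add fun ε hε => ?_
      obtain ⟨n, x, y, hz⟩ := exists_rep z
      have hlim : Tendsto (fun F : Finset S =>
          ∑ i, ‖x i‖ * ‖y i - ∑ s ∈ F, (lp.single 1 s (y i s) : L1 S)‖) atTop (nhds 0) := by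
        have : (0 : ℝ) = ∑ i, ‖x i‖ * 0 := by simp
        rw [this]
        refine tendsto_finsetSum _ fun i _ => Tendsto.const_mul _ ?_
        have h2 : Tendsto (fun F : Finset S => ∑ s ∈ F, (lp.single 1 s (y i s) : L1 S)) atTop
          (nhds (y i)) := l1_hasSum (y i)
        have h3 := (tendsto_const_nhds (x := y i)).sub h2
        rw [sub_self] at h3
        simpa using h3.norm
      obtain ⟨F, hF⟩ := (hlim.eventually (gt_mem_nhds hε)).exists
      have hrep : z = ∑ j : F ⊕ Fin n,
          (Sum.elim (fun s : F => TensorProduct.lift (tens S E) z s) x j) ⊗ₜ[ℂ]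
          (Sum.elim (fun s : F => delta (s : S))
            (fun i => y i - ∑ s ∈ F, (lp.single 1 s (y i s) : L1 S)) j) := by
        rw [Fintype.sum_sum_type]
        simp only [Sum.elim_inl, Sum.elim_inr, TensorProduct.tmul_sub, Finset.sum_sub_distrib]
        rw [← hz]
        have h4 : ∀ s, TensorProduct.lift (tens S E) z s = ∑ i, y i s • x i := by
          intro s
          rw [hz, map_sum, lp.coeFn_sum, Finset.sum_apply]
          simp [tens_apply]
        have h5 : ∑ s : F, (TensorProduct.lift (tens S E) z s) ⊗ₜ[ℂ] (delta (s : S))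
            = ∑ i, x i ⊗ₜ[ℂ] (∑ s ∈ F, (lp.single 1 s (y i s) : L1 S)) := by
          rw [Finset.sum_coe_sort F
            (fun s => (TensorProduct.lift (tens S E) z s) ⊗ₜ[ℂ] (delta (s : S)))]
          simp only [h4, TensorProduct.sum_tmul, TensorProduct.tmul_sum, single_eq_delta,
            TensorProduct.smul_tmul]
          rw [Finset.sum_comm]
        rw [h5]; abel
      refine (projNorm_le_of_rep z _ _ hrep).trans ?_
      rw [Fintype.sum_sum_type]
      simp only [Sum.elim_inl, Sum.elim_inr, norm_delta, mul_one]
      gcongr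
      rw [Finset.sum_coe_sort F (fun s => ‖TensorProduct.lift (tens S E) z s‖), l1_norm]
      exact (l1_summable _).sum_le_tsum F (fun _ _ => norm_nonneg _)
  dense := by
    intro t
    refine mem_closure_of_tendsto (l1_hasSum t) (Eventually.of_forall fun F => ?_)
    refine ⟨∑ s ∈ F, t s ⊗ₜ[ℂ] delta s, ?_⟩
    rw [map_sum]
    refine Finset.sum_congr rfl fun s _ => ?_
    rw [TensorProduct.lift.tmul, tens_delta]

theorem right_rep {S E : Type} [NormedAddCommGroup E] [NormedSpace ℂ E] [CompleteSpace E]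
    (mul : L1 S →L[ℂ] L1 S →L[ℂ] L1 S) (r : E →L[ℂ] L1 S →L[ℂ] E)
    (h : RightInduced mul r) :
    ∃ C : ℝ, 0 ≤ C ∧ ∀ x, ∃ t : lp (fun _ : S => E) 1, ‖t‖ ≤ C * ‖x‖ ∧
      HasSum (fun s => r (t s) (delta s)) x := by
  have hV : ∀ s : S, ‖r.flip (delta s)‖ ≤ ‖r‖ := fun s => by
    have := r.flip.le_opNorm (delta s)
    rwa [norm_delta, mul_one, ContinuousLinearMap.opNorm_flip] at this
  let Q : lp (fun _ : S => E) 1 →L[ℂ] E := lift1 (fun s => r.flip (delta s)) ‖r‖ hV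
  obtain ⟨e, he⟩ := h _ (tens S E) (isProj_tens S E)
  have hQ : ∀ t, e (Submodule.Quotient.mk t) = Q t := by
    intro t
    have hc : Continuous fun t => e (Submodule.Quotient.mk t) :=
      e.continuous.comp continuous_quot_mk
    have h1 : ∀ F : Finset S, e (Submodule.Quotient.mk (∑ s ∈ F, lp.single 1 s (t s)))
        = Q (∑ s ∈ F, lp.single 1 s (t s)) := by
      intro F
      rw [map_sum, ← Submodule.mkQ_apply, map_sum, map_sum]
      refine Finset.sum_congr rfl fun s _ => ?_
      rw [← tens_delta, Submodule.mkQ_apply, he, tens_delta]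
      exact (lift1_single (fun s => r.flip (delta s)) ‖r‖ hV s (t s)).symm
    have h2 := (hc.tendsto t).comp (l1_hasSum t)
    have h3 := (Q.continuous.tendsto t).comp (l1_hasSum t)
    refine tendsto_nhds_unique h2 (h3.congr fun F => ?_)
    exact (h1 F).symm
  have hsurj : Function.Surjective Q := by
    intro x
    obtain ⟨t, ht⟩ := Submodule.Quotient.mk_surjective _ (e.symm x)
    refine ⟨t, ?_⟩
    rw [← hQ, ht]; simp
  obtain ⟨C, hC, hx⟩ := Q.exists_preimage_norm_le hsurj
  refine ⟨C, hC.le, fun x => ?_⟩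
  obtain ⟨t, ht, htn⟩ := hx x
  refine ⟨t, htn, ?_⟩
  have := lift1_hasSum (fun s => r.flip (delta s)) ‖r‖ hV t
  rw [← ht]
  exact this

/-- the matrix units `(i,g,j) - ∘` -/
def eB {I G : Type} (i : I) (g : G) (j : I) : L1 (Brandt I G) :=
  delta (some (i, g, j)) - delta none

theorem norm_eB {I G : Type} (i : I) (g : G) (j : I) : ‖eB i g j‖ ≤ 2 := by
  unfold eB
  refine (norm_sub_le _ _).trans ?_
  rw [norm_delta, norm_delta]; norm_num

theorem brandt_some {I G : Type} [Mul G] (i j k n : I) (g h : G) :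
    (some (i, g, j) : Brandt I G) * some (k, h, n)
      = if j = k then some (i, g * h, n) else none := rfl

theorem brandt_none_left {I G : Type} [Mul G] (s : Brandt I G) :
    (none : Brandt I G) * s = none := rfl

theorem brandt_none_right {I G : Type} [Mul G] (s : Brandt I G) :
    s * (none : Brandt I G) = none := by
  cases s <;> rfl

theorem conv_ee {I G : Type} [Mul G] (i j k n : I) (g h : G) :
    convS (eB i g j) (eB k h n) = if j = k then eB i (g * h) n else 0 := by
  unfold eB
  simp only [map_sub, sub_apply, convS_delta, brandt_some, brandt_none_left, brandt_none_right]
  split_ifs <;> simp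

theorem conv_ee_same {I G : Type} [Mul G] (i j n : I) (g h : G) :
    convS (eB i g j) (eB j h n) = eB i (g * h) n := by
  rw [conv_ee, if_pos rfl]

theorem conv_ee_ne {I G : Type} [Mul G] (i j k n : I) (g h : G) (hjk : j ≠ k) :
    convS (eB i g j) (eB k h n) = 0 := by
  rw [conv_ee, if_neg hjk]

theorem conv_ez {I G : Type} [Mul G] (i j : I) (g : G) :
    convS (eB i g j) (delta none) = 0 := by
  unfold eB
  simp only [map_sub, sub_apply, convS_delta, brandt_none_right, sub_self]

theorem conv_ze {I G : Type} [Mul G] (i j : I) (g : G) :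
    convS (delta none) (eB i g j) = 0 := by
  unfold eB
  simp only [map_sub, convS_delta, brandt_none_left, sub_self]

theorem conv_zz {I G : Type} [Mul G] :
    convS (delta (none : Brandt I G)) (delta none) = delta none := by
  rw [convS_delta, brandt_none_left]

/-- right index of an element -/
def ridx {I G : Type} : Brandt I G → Option I
  | none => none
  | some (_, _, j) => some j

set_option maxHeartbeats 1000000 in
theorem right_sum {I G E : Type} [Group G] [NormedAddCommGroup E] [NormedSpace ℂ E]
    [CompleteSpace E] (r : E →L[ℂ] L1 (Brandt I G) →L[ℂ] E)
    (hr : ∀ x b b', r (r x b) b' = r x (convS b b')) (h : RightInduced convS r) :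
    ∃ C : ℝ, 0 ≤ C ∧ ∀ x : E, (Summable fun i : I => ‖r x (eB i 1 i)‖) ∧
      ∑' i : I, ‖r x (eB i 1 i)‖ ≤ C * ‖x‖ ∧
      HasSum (fun i : I => r x (eB i 1 i)) (x - r x (delta none)) := by
  obtain ⟨C, hC, hrep⟩ := right_rep convS r h
  refine ⟨‖r‖ * 2 * C, by positivity, fun x => ?_⟩
  obtain ⟨t, htn, ht⟩ := hrep x
  let v : Brandt I G → E := fun s => r (t s) (delta s - delta none)
  have hvn : ∀ s, ‖v s‖ ≤ ‖r‖ * 2 * ‖t s‖ := by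
    intro s
    have h1 := r.le_opNorm₂ (t s) (delta s - delta none)
    have h2 : ‖delta s - delta (none : Brandt I G)‖ ≤ 2 := by
      refine (norm_sub_le _ _).trans ?_
      rw [norm_delta, norm_delta]; norm_num
    calc ‖v s‖ ≤ ‖r‖ * ‖t s‖ * ‖delta s - delta (none : Brandt I G)‖ := h1
      _ ≤ ‖r‖ * ‖t s‖ * 2 := by gcongr
      _ = _ := by ring
  have hvs : Summable fun s => ‖v s‖ :=
    Summable.of_nonneg_of_le (fun _ => norm_nonneg _) hvn ((l1_summable t).mul_left _)
  have hvt : ∑' s, ‖v s‖ ≤ ‖r‖ * 2 * C * ‖x‖ := by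
    calc ∑' s, ‖v s‖ ≤ ∑' s, ‖r‖ * 2 * ‖t s‖ := hvs.tsum_le_tsum hvn ((l1_summable t).mul_left _)
      _ = ‖r‖ * 2 * ‖t‖ := by rw [tsum_mul_left, l1_norm]
      _ ≤ ‖r‖ * 2 * (C * ‖x‖) := by gcongr
      _ = _ := by ring
  have hv : HasSum v (x - r x (delta none)) := by
    have h1 := (r.flip (delta none)).hasSum ht
    have h2 := ht.sub h1
    refine h2.congr_fun ?_
    intro s
    simp only [ContinuousLinearMap.flip_apply, hr, convS_delta, brandt_none_right, v, map_sub]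
  let F : Brandt I G × I → E := fun p => if ridx p.1 = some p.2 then v p.1 else 0
  have hv0 : v none = 0 := by simp [v]
  have hF1 : ∀ s, HasSum (fun i => F (s, i)) (v s) := by
    intro s
    rcases s with _ | ⟨k, g, j⟩
    · simp only [F, ridx, hv0, reduceCtorEq, if_false]; exact hasSum_zero
    · simp only [F, ridx, Option.some.injEq]
      have := hasSum_ite_eq j (v (some (k, g, j)))
      simpa only [eq_comm] using this
  have hF2 : ∀ s, HasSum (fun i => ‖F (s, i)‖) ‖v s‖ := by
    intro s
    rcases s with _ | ⟨k, g, j⟩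
    · simp only [F, ridx, hv0, reduceCtorEq, if_false, norm_zero]; exact hasSum_zero
    · simp only [F, ridx, Option.some.injEq, apply_ite norm, norm_zero]
      have := hasSum_ite_eq j ‖v (some (k, g, j))‖
      simpa only [eq_comm] using this
  have hFs : Summable fun p => ‖F p‖ := by
    refine (summable_prod_of_nonneg (fun _ => norm_nonneg _)).2 ⟨fun s => (hF2 s).summable, ?_⟩
    simpa only [fun s => (hF2 s).tsum_eq] using hvs
  have hFsum : HasSum F (x - r x (delta none)) := by
    have h1 := hFs.of_norm.hasSum
    have h2 := h1.prod_fiberwise hF1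
    rwa [h2.unique hv] at h1
  have hFn : HasSum (fun p => ‖F p‖) (∑' s, ‖v s‖) := by
    have h1 := hFs.hasSum
    have h2 := h1.prod_fiberwise hF2
    rwa [h2.unique hvs.hasSum] at h1
  have hFi : ∀ i, HasSum (fun s => F (s, i)) (r x (eB i 1 i)) := by
    intro i
    have h1 := (r.flip (eB i 1 i)).hasSum ht
    refine h1.congr_fun ?_
    intro s
    simp only [ContinuousLinearMap.flip_apply, hr, F]
    rcases s with _ | ⟨k, g, j⟩
    · simp [ridx, conv_ze]
    · have h3 : (delta (some (k, g, j)) : L1 (Brandt I G)) = eB k g j + delta none := by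
        unfold eB; abel
      simp only [ridx, v, h3, map_add, add_apply, conv_ze, add_zero, add_sub_cancel_right,
        conv_ee, mul_one, Option.some.injEq]
      split_ifs with hji
      · rw [hji]
      · simp
  have hFni : ∀ i, Summable (fun s => ‖F (s, i)‖) := fun i =>
    hFs.comp_injective (i := fun s => (s, i)) (fun a b hab => (Prod.mk.inj hab).1)
  have hsw : HasSum (fun p : I × Brandt I G => F (p.2, p.1)) (x - r x (delta none)) :=
    (Equiv.prodComm I (Brandt I G)).hasSum_iff.2 hFsum
  have hswn : HasSum (fun p : I × Brandt I G => ‖F (p.2, p.1)‖) (∑' s, ‖v s‖) :=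
    (Equiv.prodComm I (Brandt I G)).hasSum_iff.2 hFn
  have hn2 := hswn.prod_fiberwise (fun i => (hFni i).hasSum)
  have hle : ∀ i, ‖r x (eB i 1 i)‖ ≤ ∑' s, ‖F (s, i)‖ := fun i => by
    rw [← (hFi i).tsum_eq]
    exact norm_tsum_le_tsum_norm (hFni i)
  have hsum : Summable fun i : I => ‖r x (eB i 1 i)‖ :=
    Summable.of_nonneg_of_le (fun _ => norm_nonneg _) hle hn2.summable
  refine ⟨hsum, ?_, hsw.prod_fiberwise hFi⟩
  refine (hsum.tsum_le_tsum hle hn2.summable).trans ?_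
  rw [hn2.tsum_eq]
  exact hvt

theorem exists_avg {I G E : Type} [Nonempty I] [Group G] (hG : AmenableGroup G)
    [NormedAddCommGroup E] [NormedSpace ℂ E] [CompleteSpace E]
    (l : L1 (Brandt I G) →L[ℂ] E →L[ℂ] E) (r : E →L[ℂ] L1 (Brandt I G) →L[ℂ] E)
    (hlaw : IsBimoduleLaw convS convS l r) (h : RightInduced convS r) :
    ∃ (Λ : (L1 (Brandt I G) →L[ℂ] (E →L[ℂ] ℂ)) →ₗ[ℂ] (E →L[ℂ] ℂ)) (K : ℝ), 0 ≤ K ∧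
    (∀ β, ‖Λ β‖ ≤ K * ‖β‖) ∧
    (∀ ψ : E →L[ℂ] ℂ, Λ ((ContinuousLinearMap.compL ℂ E E ℂ ψ).comp r.flip) = ψ) ∧
    (∀ β a, Λ (β.comp (convS.flip a)) = (Λ β).comp (r.flip a)) ∧
    (∀ β a, Λ (((ContinuousLinearMap.compL ℂ E E ℂ).flip (l a)).comp β) = (Λ β).comp (l a)) := by
  obtain ⟨μ, hμb, hμc, hμi⟩ := exists_mean hG
  obtain ⟨-, hr, hlr⟩ := hlaw
  obtain ⟨C, hC, hsum⟩ := right_sum r hr h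
  let o : I := Classical.arbitrary I
  let T : (L1 (Brandt I G) →L[ℂ] (E →L[ℂ] ℂ)) → E → I → G → ℂ := fun β x i g =>
    β (eB o g⁻¹ i) (r x (eB i g o))
  have hTb : ∀ β x i g, ‖T β x i g‖ ≤ 4 * ‖β‖ * ‖r‖ * ‖r x (eB i 1 i)‖ := by
    intro β x i g
    have h1 : r x (eB i g o) = r (r x (eB i 1 i)) (eB i g o) := by
      rw [hr, conv_ee_same, one_mul]
    have h2 := β.le_opNorm₂ (eB o g⁻¹ i) (r x (eB i g o))
    have h3 := r.le_opNorm₂ (r x (eB i 1 i)) (eB i g o)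
    rw [← h1] at h3
    calc ‖T β x i g‖ ≤ ‖β‖ * ‖(eB o g⁻¹ i : L1 (Brandt I G))‖ * ‖r x (eB i g o)‖ := h2
      _ ≤ ‖β‖ * 2 * (‖r‖ * ‖r x (eB i 1 i)‖ * 2) := by
        gcongr
        · exact norm_eB _ _ _
        · refine h3.trans ?_
          gcongr
          exact norm_eB _ _ _
      _ = _ := by ring
  have hTμ : ∀ β x i, ‖μ (T β x i)‖ ≤ 8 * ‖β‖ * ‖r‖ * ‖r x (eB i 1 i)‖ := by
    intro β x i
    refine (hμb _ _ (hTb β x i)).trans (le_of_eq (by ring))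
  have hTs : ∀ β x, Summable fun i => μ (T β x i) := fun β x =>
    Summable.of_norm_bounded ((hsum x).1.mul_left _) (hTμ β x)
  let L : (L1 (Brandt I G) →L[ℂ] (E →L[ℂ] ℂ)) → E → ℂ := fun β x =>
    ∑' i, μ (T β x i) + β (delta none) (r x (delta none))
  let K : ℝ := 8 * ‖r‖ * C + ‖r‖
  have hK : 0 ≤ K := by positivity
  have hLb : ∀ β x, ‖L β x‖ ≤ K * ‖β‖ * ‖x‖ := by
    intro β x
    have h1 : ‖∑' i, μ (T β x i)‖ ≤ 8 * ‖β‖ * ‖r‖ * (C * ‖x‖) := by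
      refine (tsum_of_norm_bounded ((hsum x).1.mul_left _).hasSum (hTμ β x)).trans ?_
      rw [tsum_mul_left]
      gcongr
      exact (hsum x).2.1
    have h2 : ‖β (delta none) (r x (delta none))‖ ≤ ‖β‖ * (‖r‖ * ‖x‖) := by
      have h3 := β.le_opNorm₂ (delta none) (r x (delta none))
      have h4 := r.le_opNorm₂ x (delta none)
      rw [norm_delta, mul_one] at h3 h4
      refine h3.trans ?_
      gcongr
    refine (norm_add_le _ _).trans ((add_le_add h1 h2).trans (le_of_eq ?_))
    simp only [K]; ring
  have hLadd : ∀ β x y, L β (x + y) = L β x + L β y := by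
    intro β x y
    have h1 : ∀ i, T β (x + y) i = T β x i + T β y i := by
      intro i; funext g; simp [T]
    simp only [L, h1, map_add, add_apply]
    rw [(hTs β x).tsum_add (hTs β y)]; ring
  have hLsmul : ∀ β (c : ℂ) x, L β (c • x) = c • L β x := by
    intro β c x
    have h1 : ∀ i, T β (c • x) i = c • T β x i := by
      intro i; funext g; simp [T]
    simp only [L, h1, map_smul, smul_apply, smul_eq_mul, tsum_mul_left]; ring
  have hLadd' : ∀ β β' x, L (β + β') x = L β x + L β' x := by
    intro β β' x
    have h1 : ∀ i, T (β + β') x i = T β x i + T β' x i := by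
      intro i; funext g; simp [T]
    simp only [L, h1, map_add, add_apply]
    rw [(hTs β x).tsum_add (hTs β' x)]; ring
  have hLsmul' : ∀ (c : ℂ) β x, L (c • β) x = c • L β x := by
    intro c β x
    have h1 : ∀ i, T (c • β) x i = c • T β x i := by
      intro i; funext g; simp [T]
    simp only [L, h1, map_smul, smul_apply, smul_eq_mul, tsum_mul_left]; ring
  let Λ : (L1 (Brandt I G) →L[ℂ] (E →L[ℂ] ℂ)) →ₗ[ℂ] (E →L[ℂ] ℂ) :=
    { toFun := fun β => LinearMap.mkContinuous
        { toFun := L β, map_add' := hLadd β, map_smul' := hLsmul β } (K * ‖β‖) (hLb β)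
      map_add' := fun β β' => by ext x; exact hLadd' β β' x
      map_smul' := fun c β => by ext x; exact hLsmul' c β x }
  have hΛ : ∀ β x, Λ β x = L β x := fun β x => rfl
  have hΛn : ∀ β, ‖Λ β‖ ≤ K * ‖β‖ := fun β =>
    ContinuousLinearMap.opNorm_le_bound _ (by positivity) (hLb β)
  have P2z : ∀ β, Λ (β.comp (convS.flip (delta none))) = (Λ β).comp (r.flip (delta none)) := by
    intro β
    ext x
    rw [ContinuousLinearMap.comp_apply, hΛ, hΛ]
    simp only [L, T, ContinuousLinearMap.comp_apply, ContinuousLinearMap.flip_apply, conv_ez,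
      conv_zz, hr, conv_ze, map_zero, zero_apply]
  have P2e : ∀ β j g k, Λ (β.comp (convS.flip (eB j g k))) = (Λ β).comp (r.flip (eB j g k)) := by
    intro β j g k
    ext x
    rw [ContinuousLinearMap.comp_apply, hΛ, hΛ]
    simp only [L, ContinuousLinearMap.comp_apply, ContinuousLinearMap.flip_apply, conv_ez,
      conv_ze, hr, map_zero, zero_apply, add_zero]
    have hz : μ (fun _ => 0) = 0 := hμc 0
    rw [tsum_eq_single j, tsum_eq_single k]
    · let Φ : G → ℂ := fun g' => β (eB o (g'⁻¹ * g) k) (r x (eB j g' o))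
      have e1 : T (β.comp (convS.flip (eB j g k))) x j = Φ := by
        funext g'
        simp only [T, Φ, ContinuousLinearMap.comp_apply, ContinuousLinearMap.flip_apply,
          conv_ee_same]
      have e2 : T β (r x (eB j g k)) k = fun g' => Φ (g * g') := by
        funext g'
        simp only [T, Φ, hr, conv_ee_same]
        congr 3
        group
      rw [e2, hμi Φ (4 * ‖β.comp (convS.flip (eB j g k))‖ * ‖r‖ * ‖r x (eB j 1 j)‖), e1]
      intro g'
      rw [← e1]
      exact hTb _ _ _ _
    · intro i hi
      have : T β (r x (eB j g k)) i = fun _ => 0 := by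
        funext g'
        simp only [T, hr, conv_ee_ne _ _ _ _ _ _ (Ne.symm hi), map_zero]
      rw [this, hz]
    · intro i hi
      have : T (β.comp (convS.flip (eB j g k))) x i = fun _ => 0 := by
        funext g'
        simp only [T, ContinuousLinearMap.comp_apply, ContinuousLinearMap.flip_apply,
          conv_ee_ne _ _ _ _ _ _ hi, map_zero, zero_apply]
      rw [this, hz]
  refine ⟨Λ, K, hK, hΛn, ?_, ?_, ?_⟩
  · intro ψ
    ext x
    rw [hΛ]
    have h1 : ∀ i, T ((ContinuousLinearMap.compL ℂ E E ℂ ψ).comp r.flip) x i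
        = fun _ => ψ (r x (eB i 1 i)) := by
      intro i; funext g
      simp only [T, ContinuousLinearMap.comp_apply, ContinuousLinearMap.compL_apply,
        ContinuousLinearMap.flip_apply, hr, conv_ee_same, mul_inv_cancel]
    simp only [L, h1, hμc]
    rw [(ψ.hasSum (hsum x).2.2).tsum_eq]
    simp only [ContinuousLinearMap.comp_apply, ContinuousLinearMap.compL_apply,
        ContinuousLinearMap.flip_apply, hr, conv_zz, map_sub, sub_add_cancel]
  · intro β a
    have hadd : ∀ a b : L1 (Brandt I G),
        Λ (β.comp (convS.flip a)) = (Λ β).comp (r.flip a) →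
        Λ (β.comp (convS.flip b)) = (Λ β).comp (r.flip b) →
        Λ (β.comp (convS.flip (a + b))) = (Λ β).comp (r.flip (a + b)) := by
      intro a b ha hb
      rw [map_add, map_add, ContinuousLinearMap.comp_add, ContinuousLinearMap.comp_add, map_add,
        ha, hb]
    have hdelta : ∀ s : Brandt I G,
        Λ (β.comp (convS.flip (delta s))) = (Λ β).comp (r.flip (delta s)) := by
      intro s
      rcases s with _ | ⟨k, g, j⟩
      · exact P2z β
      · have h3 : (delta (some (k, g, j)) : L1 (Brandt I G)) = eB k g j + delta none := by
          unfold eB; abel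
        rw [h3]
        exact hadd _ _ (P2e β k g j) (P2z β)
    ext x
    let P : L1 (Brandt I G) →L[ℂ] ℂ := LinearMap.mkContinuous
      { toFun := fun a => L (β.comp (convS.flip a)) x
        map_add' := fun a b => by
          rw [map_add, ContinuousLinearMap.comp_add, hLadd']
        map_smul' := fun c a => by
          rw [map_smul, ContinuousLinearMap.comp_smul, hLsmul']; rfl }
      (K * (‖β‖ * ‖(convS : L1 (Brandt I G) →L[ℂ] _)‖) * ‖x‖) (fun a => by
        refine (hLb _ _).trans ?_
        have h1 : ‖β.comp (convS.flip a)‖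
            ≤ ‖β‖ * (‖(convS : L1 (Brandt I G) →L[ℂ] _)‖ * ‖a‖) := by
          refine (ContinuousLinearMap.opNorm_comp_le _ _).trans ?_
          gcongr
          have := (convS : L1 (Brandt I G) →L[ℂ] _).flip.le_opNorm a
          rwa [ContinuousLinearMap.opNorm_flip] at this
        calc K * ‖β.comp (convS.flip a)‖ * ‖x‖
            ≤ K * (‖β‖ * (‖(convS : L1 (Brandt I G) →L[ℂ] _)‖ * ‖a‖)) * ‖x‖ := by gcongr
          _ = _ := by ring)
    have hPQ : P = (Λ β).comp (r x) := by
      refine l1_ext _ _ fun s c => ?_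
      rw [single_eq_delta, map_smul, map_smul]
      congr 1
      exact congrArg (fun ψ : E →L[ℂ] ℂ => ψ x) (hdelta s)
    exact congrArg (fun ψ : L1 (Brandt I G) →L[ℂ] ℂ => ψ a) hPQ
  · intro β a
    ext x
    rw [ContinuousLinearMap.comp_apply, hΛ, hΛ]
    simp only [L, T, ContinuousLinearMap.comp_apply, ContinuousLinearMap.flip_apply,
      ContinuousLinearMap.compL_apply, hlr]

theorem homotopy {A E : Type} [NormedAddCommGroup A] [NormedSpace ℂ A]
    [NormedAddCommGroup E] [NormedSpace ℂ E]
    (mul : A →L[ℂ] A →L[ℂ] A) (l : A →L[ℂ] E →L[ℂ] E) (r : E →L[ℂ] A →L[ℂ] E)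
    (Λ : (A →L[ℂ] (E →L[ℂ] ℂ)) →ₗ[ℂ] (E →L[ℂ] ℂ)) (K : ℝ) (hK : 0 ≤ K)
    (P0 : ∀ β, ‖Λ β‖ ≤ K * ‖β‖)
    (P1 : ∀ ψ : E →L[ℂ] ℂ, Λ ((ContinuousLinearMap.compL ℂ E E ℂ ψ).comp r.flip) = ψ)
    (P2 : ∀ β a, Λ (β.comp (mul.flip a)) = (Λ β).comp (r.flip a))
    (P3 : ∀ β a, Λ (((ContinuousLinearMap.compL ℂ E E ℂ).flip (l a)).comp β) = (Λ β).comp (l a))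
    (m : ℕ) (f : (Fin (m + 1) → A) → (E →L[ℂ] ℂ)) (hf : IsCochain (m + 1) f)
    (hcoc : ∀ a : Fin (m + 2) → A, cob mul l r (m + 1) f a = 0) :
    ∃ g : (Fin m → A) → (E →L[ℂ] ℂ),
      IsCochain m g ∧ ∀ a : Fin (m + 1) → A, cob mul l r m g a = f a := by
  obtain ⟨hadd, hsmul, M, hM⟩ := hf
  have hM' : ∀ (a : Fin m → A) (b : A), ‖f (Fin.cons b a)‖ ≤ (|M| * ∏ i, ‖a i‖) * ‖b‖ := by
    intro a b
    refine (hM _).trans ?_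
    rw [Fin.prod_univ_succ]
    simp only [Fin.cons_zero, Fin.cons_succ]
    have h0 : 0 ≤ ∏ i, ‖a i‖ := Finset.prod_nonneg fun _ _ => norm_nonneg _
    calc M * (‖b‖ * ∏ i, ‖a i‖) ≤ |M| * (‖b‖ * ∏ i, ‖a i‖) := by
          gcongr; exact le_abs_self M
      _ = _ := by ring
  have hup : ∀ (a : Fin m → A) (b c : A),
      (Fin.cons b a : Fin (m + 1) → A) = Function.update (Fin.cons c a) 0 b := by
    intro a b c; rw [Fin.update_cons_zero]
  let B : (Fin m → A) → (A →L[ℂ] (E →L[ℂ] ℂ)) := fun a =>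
    LinearMap.mkContinuous
      { toFun := fun b => f (Fin.cons b a)
        map_add' := fun x y => by
          rw [hup a (x + y) 0, hadd, ← hup, ← hup]
        map_smul' := fun c x => by
          rw [hup a (c • x) 0, hsmul, ← hup]; rfl } (|M| * ∏ i, ‖a i‖) (hM' a)
  have hB : ∀ a b, B a b = f (Fin.cons b a) := fun a b => rfl
  have hBn : ∀ a, ‖B a‖ ≤ |M| * ∏ i, ‖a i‖ := fun a =>
    LinearMap.mkContinuous_norm_le _
      (mul_nonneg (abs_nonneg _) (Finset.prod_nonneg fun _ _ => norm_nonneg _)) _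
  refine ⟨fun a => Λ (B a), ⟨?_, ?_, K * |M|, ?_⟩, ?_⟩
  · intro a i x y
    rw [← map_add]
    refine congrArg Λ ?_
    ext1 b
    rw [add_apply, hB, hB, hB, Fin.cons_update, Fin.cons_update,
      Fin.cons_update, hadd]
  · intro a i c x
    rw [← map_smul]
    refine congrArg Λ ?_
    ext1 b
    rw [smul_apply, hB, hB, Fin.cons_update, Fin.cons_update, hsmul]
  · intro a
    refine (P0 _).trans ?_
    rw [mul_assoc]
    gcongr
    exact hBn a
  · intro a
    have key : (ContinuousLinearMap.compL ℂ E E ℂ (f a)).comp r.flip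
        = (B (Fin.tail a)).comp (mul.flip (a 0))
          + ∑ i : Fin m, ((-1 : ℂ) ^ (i.val + 1)) • B (mergeMul (fun x y => mul x y) a i)
          + ((-1 : ℂ) ^ (m + 1)) •
            ((ContinuousLinearMap.compL ℂ E E ℂ).flip (l (a (Fin.last m)))).comp (B (Fin.init a)) := by
      ext1 b
      have h := hcoc (Fin.cons b a)
      unfold cob at h
      have e0 : mergeMul (fun x y => mul x y) (Fin.cons b a : Fin (m + 2) → A) 0
          = Fin.cons (mul b (a 0)) (Fin.tail a) := by
        funext j
        refine Fin.cases ?_ (fun j => ?_) j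
        · simp [mergeMul]
        · simp [mergeMul, Fin.tail]
      have e1 : ∀ i : Fin m, mergeMul (fun x y => mul x y) (Fin.cons b a : Fin (m + 2) → A) i.succ
          = Fin.cons b (mergeMul (fun x y => mul x y) a i) := by
        intro i
        funext j
        refine Fin.cases ?_ (fun j => ?_) j
        · simp [mergeMul]
        · simp [mergeMul]
      have e2 : Fin.init (Fin.cons b a : Fin (m + 2) → A) = Fin.cons b (Fin.init a) := by
        funext j
        refine Fin.cases ?_ (fun j => ?_) j
        · simp [Fin.init]
        · simp [Fin.init]
      have e3 : (Fin.cons b a : Fin (m + 2) → A) (Fin.last (m + 1)) = a (Fin.last m) := by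
        rw [← Fin.succ_last, Fin.cons_succ]
      rw [Fin.sum_univ_succ, e0, e2, e3] at h
      simp only [e1, Fin.tail_cons, Fin.cons_zero, Fin.val_zero, Fin.val_succ, zero_add,
        pow_one] at h
      ext x
      have hx := congrArg (fun ψ : E →L[ℂ] ℂ => ψ x) h
      simp only [add_apply, sum_apply, smul_apply, zero_apply, ContinuousLinearMap.comp_apply,
        ContinuousLinearMap.flip_apply, smul_eq_mul, pow_succ _ (_ + 1), mul_neg_one, neg_mul,
        Finset.sum_neg_distrib, one_mul] at hx
      simp only [add_apply, sum_apply,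
        smul_apply, ContinuousLinearMap.comp_apply,
        ContinuousLinearMap.flip_apply, ContinuousLinearMap.compL_apply, hB, smul_eq_mul]
      linear_combination hx
    have h2 := congrArg Λ key
    rw [P1, map_add, map_add, map_sum, P2, map_smul, P3] at h2
    simp only [map_smul] at h2
    exact h2.symm

end Helpers

/-- Let `G` be an amenable discrete group, `I` a nonempty set and
`A = ℓ¹(B(I,G))`.  For every two-sided `A`-induced Banach `A`-bimodule `E` and every
`n > 0`, the bounded Hochschild cohomology `ℋⁿ(A,E*)` with coefficients in the dual
bimodule `E*` is trivial: every bounded `n`-cocycle with values in `E*` is the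
coboundary of a bounded `(n-1)`-cochain (here `n = m + 1`). -/
theorem brandt_morita_stmt15 (I G : Type) [Nonempty I] [Group G]
    (hG : AmenableGroup G) :
    ∃ mulS : L1 (Brandt I G) →L[ℂ] L1 (Brandt I G) →L[ℂ] L1 (Brandt I G),
      (∀ (a b : L1 (Brandt I G)) (s : Brandt I G), mulS a b s = l1conv a b s) ∧
      ∀ (E : Type) [NormedAddCommGroup E] [NormedSpace ℂ E] [CompleteSpace E]
        (l : L1 (Brandt I G) →L[ℂ] E →L[ℂ] E) (r : E →L[ℂ] L1 (Brandt I G) →L[ℂ] E),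
        IsBimoduleLaw mulS mulS l r →
        LeftInduced mulS l → RightInduced mulS r →
        ∀ (m : ℕ) (f : (Fin (m + 1) → L1 (Brandt I G)) → (E →L[ℂ] ℂ)),
          IsCochain (m + 1) f →
          (∀ a : Fin (m + 2) → L1 (Brandt I G), cob mulS l r (m + 1) f a = 0) →
          ∃ g : (Fin m → L1 (Brandt I G)) → (E →L[ℂ] ℂ),
            IsCochain m g ∧
            ∀ a : Fin (m + 1) → L1 (Brandt I G), cob mulS l r m g a = f a := by
  refine ⟨convS, convS_apply, ?_⟩
  intro E _ _ _ l r hlaw _ hR m f hf hcoc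
  obtain ⟨Λ, K, hK, P0, P1, P2, P3⟩ := exists_avg hG l r hlaw hR
  exact homotopy convS l r Λ K hK P0 P1 P2 P3 m f hf hcoc
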